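/- arXiv:2010.05245 — 8 statements merged into one kernel-verified Lean document; each statement's English description precedes it below -/
import Mathlib

section
/- If n ≥ 1 and φ : B → ℤ satisfies S(φ) = (2n+1)·e_1 (i.e. S(φ)(1) = 2n+1 and S(φ)(i) = 0 for all 2 ≤ i ≤ n), then Σ_{v∈B} |φ(v)| ≥ 2n. -/
/-- The `j`-th standard basis vector of `ℤⁿ` (indices are 1-based),
with the convention that it is the zero vector when `j > n` (or `j = 0`). -/
def stdVec (n : ℕ) (j : ℕ) : Fin n → ℤ := fun i => if (i : ℕ) + 1 = j then 1 else 0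

/-- The finite set `B ⊆ ℤⁿ` consisting of the vectors `2e_i` (`1 ≤ i ≤ n`),
`e_i + e_{i+1}` (`1 ≤ i ≤ n`), `e_i − e_{i+1}` (`1 ≤ i ≤ n`), `2e_1 − 2e_2`,
and `e_i − 2e_{i+1} + e_{i+2}` (`1 ≤ i ≤ n`). -/
def Bset (n : ℕ) : Finset (Fin n → ℤ) :=
  ((Finset.Icc 1 n).image fun i => 2 • stdVec n i) ∪
  ((Finset.Icc 1 n).image fun i => stdVec n i + stdVec n (i + 1)) ∪
  ((Finset.Icc 1 n).image fun i => stdVec n i - stdVec n (i + 1)) ∪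
  {2 • stdVec n 1 - 2 • stdVec n 2} ∪
  ((Finset.Icc 1 n).image fun i => stdVec n i - 2 • stdVec n (i + 1) + stdVec n (i + 2))

/-- The `i`-th coordinate (1-based) of a vector `w ∈ ℤⁿ`. -/
def coord {n : ℕ} (w : Fin n → ℤ) (i : ℕ) : ℤ :=
  if h : i - 1 < n then w ⟨i - 1, h⟩ else 0

/-- `S(φ) = Σ_{v ∈ B} φ(v)·v ∈ ℤⁿ`. -/
def Ssum {n : ℕ} (φ : (Fin n → ℤ) → ℤ) : Fin n → ℤ := ∑ v ∈ Bset n, φ v • v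

/-- `|φ| = Σ_{v ∈ B} |φ(v)|`. -/
def absSum {n : ℕ} (φ : (Fin n → ℤ) → ℤ) : ℤ := ∑ v ∈ Bset n, |φ v|

/-- Coefficients on an image of a finite set can be pulled back to the index set. -/
lemma exists_pullback_coeff_image {ι M : Type*} [DecidableEq ι] [DecidableEq M] [AddCommGroup M]
    (I : Finset ι) (g : ι → M) (φ : M → ℤ) :
    ∃ ψ : ι → ℤ, (∀ i ∉ I, ψ i = 0) ∧
      ∑ v ∈ I.image g, φ v • v = ∑ i ∈ I, ψ i • g i ∧
      ∑ v ∈ I.image g, |φ v| = ∑ i ∈ I, |ψ i| := by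
  obtain ⟨J, hJI, hinj, himg⟩ := Finset.exists_subset_injOn_image_eq_of_surjOn (f := g)
    (I : Set ι) (I.image g) (by simpa using Set.surjOn_image g I)
  rw [Finset.coe_subset] at hJI
  refine ⟨fun i => if i ∈ J then φ (g i) else 0, fun i hi => if_neg fun h => hi (hJI h), ?_, ?_⟩
  · rw [← himg, Finset.sum_image hinj, ← Finset.sum_subset hJI fun i _ hi => by simp [hi]]
    exact Finset.sum_congr rfl fun i hi => by simp [hi]
  · rw [← himg, Finset.sum_image hinj, ← Finset.sum_subset hJI fun i _ hi => by simp [hi]]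
    exact Finset.sum_congr rfl fun i hi => by simp [hi]

lemma sum_union_eq_add {M A : Type*} [DecidableEq M] [AddCommMonoid A]
    (s t : Finset M) (F : M → A) :
    ∑ v ∈ s ∪ t, F v = ∑ v ∈ s, F v + ∑ v ∈ t, if v ∈ s then 0 else F v := by
  rw [← Finset.union_sdiff_self_eq_union, Finset.sum_union Finset.disjoint_sdiff]
  congr 1
  rw [Finset.sdiff_eq_filter, Finset.sum_filter]
  simp only [ite_not]

/-- Coefficients on a union split into coefficients on the two parts. -/
lemma exists_split_coeff_union {M : Type*} [DecidableEq M] [AddCommGroup M]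
    (s t : Finset M) (φ : M → ℤ) :
    ∃ ψ : M → ℤ,
      ∑ v ∈ s ∪ t, φ v • v = ∑ v ∈ s, φ v • v + ∑ v ∈ t, ψ v • v ∧
      ∑ v ∈ s ∪ t, |φ v| = ∑ v ∈ s, |φ v| + ∑ v ∈ t, |ψ v| := by
  refine ⟨fun v => if v ∈ s then 0 else φ v, ?_, ?_⟩
  · rw [sum_union_eq_add]
    congr 1
    refine Finset.sum_congr rfl fun v _ => ?_
    beta_reduce
    split_ifs <;> simp
  · rw [sum_union_eq_add]
    congr 1
    refine Finset.sum_congr rfl fun v _ => ?_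
    beta_reduce
    split_ifs <;> simp

/-- The part of the cost lower bound along a chain that depends on the initial state. -/
def chainBound (r x : ℤ) : ℤ :=
  if (r = -1 ∧ x = 2) ∨ (r = 1 ∧ x = -2) then 0 else (|r + x| + 1) / 2

lemma chainBound_step (a b c f r x : ℤ) (hr : Odd r) (h : b + c + f = r + x) :
    1 + chainBound r x ≤ |a| + |b| + |c| + |f| + chainBound (r - 2 * (a + b)) f := by
  obtain ⟨k, rfl⟩ := hr
  unfold chainBound
  have ha := le_abs_self a
  have ha' := neg_le_abs a
  have hb := le_abs_self b
  have hb' := neg_le_abs b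
  have hc := le_abs_self c
  have hc' := neg_le_abs c
  have hf := le_abs_self f
  have hf' := neg_le_abs f
  have hy := le_abs_self (2 * k + 1 - 2 * (a + b) + f)
  have hy' := neg_le_abs (2 * k + 1 - 2 * (a + b) + f)
  have hle : |2 * k + 1 + x| ≤ |b| + |c| + |f| := h ▸ abs_add_three b c f
  have hx := abs_choice (2 * k + 1 + x)
  generalize |2 * k + 1 - 2 * (a + b) + f| = y at *
  generalize |2 * k + 1 + x| = z at *
  generalize |a| = A at *
  generalize |b| = B at *
  generalize |c| = C at *
  generalize |f| = F at *
  by_cases hbig : 2 ≤ A + B + C + F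
  · split_ifs <;> omega
  · have : a = 0 ∨ a = 1 ∨ a = -1 := by omega
    have : b = 0 ∨ b = 1 ∨ b = -1 := by omega
    have : c = 0 ∨ c = 1 ∨ c = -1 := by omega
    have : f = 0 ∨ f = 1 ∨ f = -1 := by omega
    split_ifs <;> omega

lemma chainBound_le (b c f r x : ℤ) (h : b + c + f = r + x) :
    chainBound r x ≤ |b| + |c| + |f| := by
  unfold chainBound
  split_ifs <;> grind

/-- Lower bound for the cost of a chain of length `N + 1`. -/
lemma le_chain_cost (N : ℕ) (a b c f R X : ℕ → ℤ) (hodd : Odd (R 0))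
    (hR : ∀ k, R (k + 1) = R k - 2 * (a (k + 1) + b k)) (hX : ∀ k, X (k + 1) = f k)
    (h : ∀ k ≤ N, b k + c k + f k = R k + X k) :
    N + chainBound (R 0) (X 0) ≤
      ∑ j ∈ Finset.range N, |a (j + 1)| +
        ∑ j ∈ Finset.range (N + 1), (|b j| + |c j| + |f j|) := by
  induction N generalizing a b c f R X with
  | zero => simpa using chainBound_le _ _ _ _ _ (h 0 le_rfl)
  | succ N ih =>
    have hodd' : Odd (R (0 + 1)) := by
      rw [hR]
      exact hodd.sub_even (even_two_mul _)
    have ih' := ih (fun k => a (k + 1)) (fun k => b (k + 1)) (fun k => c (k + 1))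
      (fun k => f (k + 1)) (fun k => R (k + 1)) (fun k => X (k + 1)) hodd'
      (fun k => hR (k + 1)) (fun k => hX (k + 1)) (fun k hk => h (k + 1) (by lia))
    have step := chainBound_step (a 1) (b 0) (c 0) (f 0) (R 0) (X 0) hodd (h 0 (by lia))
    rw [Finset.sum_range_succ', Finset.sum_range_succ' _ (N + 1)]
    simp only [hR 0, hX 0, zero_add] at ih' ⊢
    push_cast
    linarith

lemma chainBound_start (m d : ℤ) :
    1 + m ≤ |d| + chainBound (2 * m + 1) (-2 * d) := by
  unfold chainBound
  split_ifs <;> grind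

/-- Expansion of `φ` along the indexed families of vectors making up `Bset n`. -/
lemma exists_family_coeff (n : ℕ) (φ : (Fin n → ℤ) → ℤ) :
    ∃ (a b c f : ℕ → ℤ) (d : ℤ), (b 0 = 0 ∧ c 0 = 0 ∧ f 0 = 0) ∧
      Ssum φ = ∑ i ∈ Finset.Icc 1 n, a i • (2 • stdVec n i) +
        ∑ i ∈ Finset.Icc 1 n, b i • (stdVec n i + stdVec n (i + 1)) +
        ∑ i ∈ Finset.Icc 1 n, c i • (stdVec n i - stdVec n (i + 1)) +
        d • (2 • stdVec n 1 - 2 • stdVec n 2) +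
        ∑ i ∈ Finset.Icc 1 n, f i • (stdVec n i - 2 • stdVec n (i + 1) + stdVec n (i + 2)) ∧
      absSum φ = ∑ i ∈ Finset.Icc 1 n, |a i| + ∑ i ∈ Finset.Icc 1 n, |b i| +
        ∑ i ∈ Finset.Icc 1 n, |c i| + |d| + ∑ i ∈ Finset.Icc 1 n, |f i| := by
  unfold Ssum absSum Bset
  obtain ⟨φf, hf, hf'⟩ := exists_split_coeff_union
    (((Finset.Icc 1 n).image fun i => 2 • stdVec n i) ∪
      ((Finset.Icc 1 n).image fun i => stdVec n i + stdVec n (i + 1)) ∪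
      ((Finset.Icc 1 n).image fun i => stdVec n i - stdVec n (i + 1)) ∪
      {2 • stdVec n 1 - 2 • stdVec n 2})
    ((Finset.Icc 1 n).image fun i => stdVec n i - 2 • stdVec n (i + 1) + stdVec n (i + 2)) φ
  obtain ⟨φd, hd, hd'⟩ := exists_split_coeff_union
    (((Finset.Icc 1 n).image fun i => 2 • stdVec n i) ∪
      ((Finset.Icc 1 n).image fun i => stdVec n i + stdVec n (i + 1)) ∪
      ((Finset.Icc 1 n).image fun i => stdVec n i - stdVec n (i + 1)))
    {2 • stdVec n 1 - 2 • stdVec n 2} φ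
  obtain ⟨φc, hc, hc'⟩ := exists_split_coeff_union
    (((Finset.Icc 1 n).image fun i => 2 • stdVec n i) ∪
      ((Finset.Icc 1 n).image fun i => stdVec n i + stdVec n (i + 1)))
    ((Finset.Icc 1 n).image fun i => stdVec n i - stdVec n (i + 1)) φ
  obtain ⟨φb, hb, hb'⟩ := exists_split_coeff_union
    ((Finset.Icc 1 n).image fun i => 2 • stdVec n i)
    ((Finset.Icc 1 n).image fun i => stdVec n i + stdVec n (i + 1)) φ
  obtain ⟨a, -, ha, ha'⟩ := exists_pullback_coeff_image (Finset.Icc 1 n)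
    (fun i => 2 • stdVec n i) φ
  obtain ⟨b, b0, hb₂, hb₂'⟩ := exists_pullback_coeff_image (Finset.Icc 1 n)
    (fun i => stdVec n i + stdVec n (i + 1)) φb
  obtain ⟨c, c0, hc₂, hc₂'⟩ := exists_pullback_coeff_image (Finset.Icc 1 n)
    (fun i => stdVec n i - stdVec n (i + 1)) φc
  obtain ⟨f, f0, hf₂, hf₂'⟩ := exists_pullback_coeff_image (Finset.Icc 1 n)
    (fun i => stdVec n i - 2 • stdVec n (i + 1) + stdVec n (i + 2)) φf
  refine ⟨a, b, c, f, φd (2 • stdVec n 1 - 2 • stdVec n 2),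
    ⟨b0 0 (by simp), c0 0 (by simp), f0 0 (by simp)⟩, ?_, ?_⟩
  · rw [hf, hd, hc, hb, ha, hb₂, hc₂, hf₂, Finset.sum_singleton]
  · rw [hf', hd', hc', hb', ha', hb₂', hc₂', hf₂', Finset.sum_singleton]

lemma sum_Icc_mul_stdVec (n : ℕ) (u : ℕ → ℤ) (j : Fin n) (s : ℕ)
    (hu : s = 0 ∨ u 0 = 0) :
    ∑ i ∈ Finset.Icc 1 n, u i * stdVec n (i + s) j =
      if s ≤ (j : ℕ) + 1 then u ((j : ℕ) + 1 - s) else 0 := by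
  unfold stdVec
  have hj := j.2
  split_ifs with hs
  · rw [Finset.sum_eq_single ((j : ℕ) + 1 - s)]
    · rw [if_pos (by lia), mul_one]
    · intro i _ hi
      rw [if_neg (by lia), mul_zero]
    · intro h
      rw [Finset.mem_Icc] at h
      have : (j : ℕ) + 1 - s = 0 := by lia
      rw [this, hu.resolve_left (by lia), zero_mul]
  · refine Finset.sum_eq_zero fun i _ => ?_
    rw [if_neg (by lia), mul_zero]

/-- If `n ≥ 1` and `φ : B → ℤ` satisfies `S(φ) = (2n+1)·e_1`, then
`Σ_{v ∈ B} |φ(v)| ≥ 2n`. -/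
theorem stmt_0 (n : ℕ) (hn : 1 ≤ n) (φ : (Fin n → ℤ) → ℤ)
    (hS : Ssum φ = (2 * (n : ℤ) + 1) • stdVec n 1) :
    2 * (n : ℤ) ≤ absSum φ := by
  obtain ⟨a, b, c, f, d, ⟨b0, c0, f0⟩, hsum, habs⟩ := exists_family_coeff n φ
  have coordEq : ∀ j (hj : j < n),
      2 * a (j + 1) + (b (j + 1) + b j) + (c (j + 1) - c j) +
        d * (2 * (if j = 0 then 1 else 0) - 2 * (if j = 1 then 1 else 0)) +
        (f (j + 1) - 2 * f j + if 1 ≤ j then f (j - 1) else 0) =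
      (2 * n + 1) * if j = 0 then 1 else 0 := by
    intro j hj
    have h := congrFun (hsum.symm.trans hS) ⟨j, hj⟩
    have e : ∀ (u : ℕ → ℤ) (s : ℕ), s = 0 ∨ u 0 = 0 → _ :=
      fun u s => sum_Icc_mul_stdVec n u ⟨j, hj⟩ s
    have ea := e a 0 (.inl rfl)
    have eb := e b 0 (.inl rfl)
    have eb' := e b 1 (.inr b0)
    have ec := e c 0 (.inl rfl)
    have ec' := e c 1 (.inr c0)
    have ef := e f 0 (.inl rfl)
    have ef' := e f 1 (.inr f0)
    have ef'' := e f 2 (.inr f0)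
    simp only [add_zero, if_true, Nat.sub_zero, Nat.le_add_left,
      Nat.add_sub_cancel] at ea eb eb' ec ec' ef ef' ef''
    have two_apply : ∀ v : Fin n → ℤ, (2 • v) ⟨j, hj⟩ = 2 * v ⟨j, hj⟩ := fun v => by simp
    simp only [two_apply, Pi.add_apply, Finset.sum_apply, Pi.smul_apply, Pi.sub_apply, smul_eq_mul,
      mul_add, mul_sub, Finset.sum_add_distrib,
      Finset.sum_sub_distrib, mul_left_comm _ (2 : ℤ), ← Finset.mul_sum,
      ea, eb, eb', ec, ec', ef, ef', ef''] at h
    rcases j with _ | _ | j <;> simp [stdVec] at h ⊢ <;> linarith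
  let R : ℕ → ℤ := fun k => 2 * n + 1 - 2 * a 1 -
    2 * ∑ j ∈ Finset.range k, (a (j + 2) + b (j + 1))
  let X : ℕ → ℤ := fun k => if k = 0 then -2 * d else f k
  have hR : ∀ k, R (k + 1) = R k - 2 * (a (k + 1 + 1) + b (k + 1)) := by
    intro k
    simp only [R, Finset.sum_range_succ]
    ring
  have hR0 : R 0 = 2 * (n - a 1) + 1 := by
    simp only [R, Finset.sum_range_zero]
    ring
  have hX : ∀ k, X (k + 1) = f (k + 1) := fun k => rfl
  obtain ⟨N, rfl⟩ : ∃ N, n = N + 1 := ⟨n - 1, by lia⟩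
  have hy : ∀ k ≤ N, b (k + 1) + c (k + 1) + f (k + 1) = R k + X k := by
    intro k
    induction k with
    | zero =>
      intro _
      have h := coordEq 0 (by lia)
      simp only [b0, c0, f0] at h
      simp only [hR0, X]
      norm_num at h ⊢
      linarith
    | succ k ih =>
      intro hk
      have h := coordEq (k + 1) (by lia)
      have ih := ih (by lia)
      rw [hR, hX]
      rcases k with _ | k
      · simp only [X] at ih
        norm_num [f0] at h ih ⊢
        linarith
      · rw [hX] at ih
        norm_num at h ih ⊢
        linarith
  have chain := le_chain_cost N (fun k => a (k + 1)) (fun k => b (k + 1)) (fun k => c (k + 1))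
    (fun k => f (k + 1)) R X ⟨_, hR0⟩ hR hX hy
  have hstart := chainBound_start ((N + 1 : ℕ) - a 1) d
  have hX0 : X 0 = -2 * d := rfl
  rw [hR0, hX0] at chain
  have shift : ∀ u : ℕ → ℤ, ∑ i ∈ Finset.Icc 1 (N + 1), |u i| =
      ∑ j ∈ Finset.range (N + 1), |u (j + 1)| := by
    intro u
    rw [Finset.range_eq_Ico, Finset.sum_Ico_add' (fun i => |u i|) 0 (N + 1) 1]
    rfl
  rw [habs, shift, shift, shift, shift, Finset.sum_range_succ' (fun j => |a (j + 1)|)]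
  simp only [Finset.sum_add_distrib] at chain
  have ha := le_abs_self (a 1)
  push_cast at *
  linarith
end

section
/- For every n ≥ 1 there exists a function φ : B → ℤ with Σ_{v∈B} |φ(v)| = 2n and S(φ) = (2n+1)·e_1; explicitly, taking coefficient n on the vector 2e_1 and coefficient (−1)^{i−1} on the vector e_i + e_{i+1} for each 1 ≤ i ≤ n yields n·(2e_1) + Σ_{i=1}^{n} (−1)^{i−1}(e_i + e_{i+1}) = (2n+1)·e_1 in ℤⁿ. -/
/-- Coefficients prescribed along a finite injective family of members of `B` extend by zero to
a function on `B`, preserving both the absolute sum and the weighted vector sum. -/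
theorem exists_coeff_of_injOn {n : ℕ} {ι : Type*} (s : Finset ι) (f : ι → Fin n → ℤ) (c : ι → ℤ)
    (hf : Set.InjOn f s) (hB : ∀ i ∈ s, f i ∈ Bset n) :
    ∃ φ : (Fin n → ℤ) → ℤ,
      absSum φ = ∑ i ∈ s, |c i| ∧ Ssum φ = ∑ i ∈ s, c i • f i := by
  classical
  have hext : ∃ φ : (Fin n → ℤ) → ℤ, (∀ i ∈ s, φ (f i) = c i) ∧ ∀ v ∉ s.image f, φ v = 0 := by
    rcases isEmpty_or_nonempty ι with h | h
    · exact ⟨0, fun i => h.elim i, fun _ _ => rfl⟩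
    · refine ⟨fun v => if v ∈ s.image f then c (Function.invFunOn f s v) else 0,
        fun i hi => ?_, fun v hv => if_neg hv⟩
      simp only [Finset.mem_image_of_mem f hi, if_true]
      rw [hf.leftInvOn_invFunOn hi]
  obtain ⟨φ, hφ, hφ0⟩ := hext
  have hsub : s.image f ⊆ Bset n := Finset.image_subset_iff.2 hB
  refine ⟨φ, ?_, ?_⟩
  · rw [absSum, ← Finset.sum_subset hsub fun v _ hv => by simp [hφ0 v hv],
      Finset.sum_image hf]
    exact Finset.sum_congr rfl fun i hi => by rw [hφ i hi]
  · rw [Ssum, ← Finset.sum_subset hsub fun v _ hv => by simp [hφ0 v hv],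
      Finset.sum_image hf]
    exact Finset.sum_congr rfl fun i hi => by rw [hφ i hi]

theorem stdVec_add_stdVec_succ_injOn (n : ℕ) :
    Set.InjOn (fun i => stdVec n i + stdVec n (i + 1)) (Finset.Icc 1 n) := by
  have key : ∀ i j, 1 ≤ i → i ≤ n → i < j →
      stdVec n i + stdVec n (i + 1) ≠ stdVec n j + stdVec n (j + 1) := by
    intro i j hi hin hij h
    have h' := congrFun h ⟨i - 1, by omega⟩
    simp only [stdVec, Pi.add_apply] at h'
    split_ifs at h' <;> omega
  intro i hi j hj h
  simp only [Finset.coe_Icc, Set.mem_Icc] at hi hj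
  rcases lt_trichotomy i j with hij | hij | hij
  · exact (key i j hi.1 hi.2 hij h).elim
  · exact hij
  · exact (key j i hj.1 hj.2 hij h.symm).elim

theorem two_smul_stdVec_one_ne {n : ℕ} (hn : 1 ≤ n) (i : ℕ) :
    2 • stdVec n 1 ≠ stdVec n i + stdVec n (i + 1) := by
  intro h
  have h' := congrFun h ⟨0, hn⟩
  simp only [stdVec, Pi.add_apply, Pi.smul_apply] at h'
  split_ifs at h' <;> simp at h' <;> omega

theorem stdVec_succ_self (n : ℕ) : stdVec n (n + 1) = 0 := by
  funext i
  have := i.isLt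
  simp only [stdVec, Pi.zero_apply, ite_eq_right_iff]
  omega

theorem sum_alternating_stdVec (n m : ℕ) :
    ∑ i ∈ Finset.Icc 1 m, ((-1 : ℤ) ^ (i - 1)) • (stdVec n i + stdVec n (i + 1)) =
      stdVec n 1 - ((-1 : ℤ) ^ m) • stdVec n (m + 1) := by
  induction m with
  | zero => simp
  | succ m ih =>
    rw [Finset.sum_Icc_succ_top (by omega), ih, Nat.add_sub_cancel, pow_succ]
    module

theorem explicit_combination (n : ℕ) :
    (n : ℤ) • (2 • stdVec n 1) +
        ∑ i ∈ Finset.Icc 1 n, ((-1 : ℤ) ^ (i - 1)) • (stdVec n i + stdVec n (i + 1)) =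
      (2 * (n : ℤ) + 1) • stdVec n 1 := by
  rw [sum_alternating_stdVec, stdVec_succ_self]
  module

/-- For every `n ≥ 1` there is `φ : B → ℤ` with `Σ_{v ∈ B} |φ(v)| = 2n` and
`S(φ) = (2n+1)·e_1`; explicitly,
`n·(2e_1) + Σ_{i=1}^{n} (−1)^{i−1}(e_i + e_{i+1}) = (2n+1)·e_1` in `ℤⁿ`. -/
theorem stmt_1 (n : ℕ) (hn : 1 ≤ n) :
    (∃ φ : (Fin n → ℤ) → ℤ,
      absSum φ = 2 * (n : ℤ) ∧ Ssum φ = (2 * (n : ℤ) + 1) • stdVec n 1) ∧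
    (n : ℤ) • (2 • stdVec n 1) +
        ∑ i ∈ Finset.Icc 1 n, ((-1 : ℤ) ^ (i - 1)) • (stdVec n i + stdVec n (i + 1)) =
      (2 * (n : ℤ) + 1) • stdVec n 1 := by
  refine ⟨?_, explicit_combination n⟩
  obtain ⟨φ, habs, hsum⟩ := exists_coeff_of_injOn (Finset.insertNone (Finset.Icc 1 n))
    (fun o => o.elim (2 • stdVec n 1) fun i => stdVec n i + stdVec n (i + 1))
    (fun o => o.elim (n : ℤ) fun i => (-1 : ℤ) ^ (i - 1))
    (by
      rintro (_ | i) hi (_ | j) hj h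
      · rfl
      · exact (two_smul_stdVec_one_ne hn j h).elim
      · exact (two_smul_stdVec_one_ne hn i h.symm).elim
      · exact congrArg some (stdVec_add_stdVec_succ_injOn n
          (Finset.some_mem_insertNone.1 hi) (Finset.some_mem_insertNone.1 hj) h))
    (by
      rintro (_ | i) hi
      · have h : 2 • stdVec n 1 ∈ (Finset.Icc 1 n).image fun i => 2 • stdVec n i :=
          Finset.mem_image_of_mem (fun i => 2 • stdVec n i) (Finset.mem_Icc.2 ⟨le_rfl, hn⟩)
        simp only [Bset, Finset.mem_union, Option.elim]
        exact .inl (.inl (.inl (.inl h)))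
      · have h : stdVec n i + stdVec n (i + 1) ∈
            (Finset.Icc 1 n).image fun i => stdVec n i + stdVec n (i + 1) :=
          Finset.mem_image_of_mem (fun i => stdVec n i + stdVec n (i + 1))
            (Finset.some_mem_insertNone.1 hi)
        simp only [Bset, Finset.mem_union, Option.elim]
        exact .inl (.inl (.inl (.inr h))))
  rw [Finset.sum_insertNone] at habs hsum
  refine ⟨φ, ?_, hsum.trans (explicit_combination n)⟩
  rw [habs]
  simp [abs_pow, two_mul]
end

section
/- For every n ≥ 1, the minimum of Σ_{v∈B} |φ(v)| over all functions φ : B → ℤ satisfying S(φ) = (2n+1)·e_1 is exactly 2n. -/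
/-- The generators listed in `Bset`, indexed with repetitions. -/
def genVec (n : ℕ) : Option (Fin 4 × ℕ) → Fin n → ℤ
  | none => 2 • stdVec n 1 - 2 • stdVec n 2
  | some (t, i) => ![2 • stdVec n i, stdVec n i + stdVec n (i + 1), stdVec n i - stdVec n (i + 1),
      stdVec n i - 2 • stdVec n (i + 1) + stdVec n (i + 2)] t

lemma Bset_eq_image_genVec (n : ℕ) :
    Bset n = (Finset.insertNone (Finset.univ ×ˢ Finset.Icc 1 n)).image (genVec n) := by
  ext v
  simp only [Bset, Finset.mem_union, Finset.mem_image, Finset.mem_singleton, Option.exists,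
    Finset.none_mem_insertNone, Finset.some_mem_insertNone, Finset.mem_product, Finset.mem_univ,
    true_and, Prod.exists, Fin.exists_fin_succ, genVec]
  simp
  grind

/-- A weighted sum over the image of an indexed family is a weighted sum over the indices with the
same total absolute weight. -/
lemma exists_index_weights {ι M : Type*} [DecidableEq ι] [DecidableEq M] [AddCommGroup M]
    (s : Finset ι) (f : ι → M) (φ : M → ℤ) :
    ∃ ψ : ι → ℤ, (∀ i ∉ s, ψ i = 0) ∧ ∑ i ∈ s, ψ i • f i = ∑ v ∈ s.image f, φ v • v ∧
      ∑ i ∈ s, |ψ i| = ∑ v ∈ s.image f, |φ v| := by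
  obtain ⟨u, hu, hinj, himg⟩ := Finset.exists_subset_injOn_image_eq_of_surjOn s (s.image f) (f := f) (by
    rw [Finset.coe_image]; exact Set.surjOn_image f s)
  refine ⟨fun i => if i ∈ u then φ (f i) else 0, fun i hi => if_neg fun h => hi (hu h), ?_, ?_⟩
  · rw [← himg, Finset.sum_image hinj]
    simp only [ite_smul, zero_smul]
    rw [← Finset.sum_filter, Finset.filter_mem_eq_inter, Finset.inter_eq_right.mpr hu]
  · rw [← himg, Finset.sum_image hinj]
    simp only [apply_ite abs, abs_zero]
    rw [← Finset.sum_filter, Finset.filter_mem_eq_inter, Finset.inter_eq_right.mpr hu]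

/-- A potential bounding the cost of the remaining coordinates from below, where `r` is the
remaining (odd) partial coordinate sum and `g` is the carry from the previous coordinate. -/
def potential (r g : ℤ) : ℤ := if 0 < r then (r + g + 1) / 2 else (-r - g + 1) / 2

lemma potential_step {r g a b c g' : ℤ} (hr : r % 2 = 1) (h : r + g = b + c + g') :
    potential r g + 1 ≤ |b| + |c| + |g'| + |a| + potential (r - 2 * a - 2 * b) g' := by
  have := le_abs_self a; have := neg_le_abs a
  have := le_abs_self b; have := neg_le_abs b
  have := le_abs_self c; have := neg_le_abs c
  have := le_abs_self g'; have := neg_le_abs g'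
  unfold potential
  split_ifs <;> omega

lemma potential_le_abs (r g : ℤ) : potential r g ≤ |r + g| := by
  have := le_abs_self (r + g); have := neg_le_abs (r + g)
  unfold potential
  split_ifs <;> omega

lemma two_mul_le_of_recurrence (m : ℕ) (a b c g : ℕ → ℤ) (d : ℤ) (hg : g 0 = -2 * d)
    (h₁ : 2 * a 1 + b 1 + c 1 + g 1 - g 0 = 2 * (m + 1) + 1)
    (h₂ : ∀ k < m, 2 * a (k + 2) + b (k + 2) + b (k + 1) + c (k + 2) - c (k + 1) + g (k + 2)
      - 2 * g (k + 1) + g k = 0) :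
    2 * ((m : ℤ) + 1) ≤
      |d| + ∑ k ∈ Finset.range (m + 1), (|a (k + 1)| + |b (k + 1)| + |c (k + 1)| + |g (k + 1)|) := by
  set r : ℕ → ℤ := fun k => b (k + 1) + c (k + 1) + g (k + 1) - g k with hr
  have hstep : ∀ k < m, r (k + 1) = r k - 2 * a (k + 2) - 2 * b (k + 1) := fun k hk => by
    have := h₂ k hk
    simp only [hr]
    linarith
  have hodd : ∀ k ≤ m, r k % 2 = 1 := by
    intro k hk
    induction k with
    | zero => simp only [hr, zero_add]; omega
    | succ k ih => have := ih (by omega); have := hstep k (by omega); omega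
  have htel : ∀ j ≤ m, potential (r 0) (g 0) + j + |a 1| ≤
      ∑ k ∈ Finset.range j, (|a (k + 1)| + |b (k + 1)| + |c (k + 1)| + |g (k + 1)|) + |a (j + 1)|
        + potential (r j) (g j) := by
    intro j hj
    induction j with
    | zero => simp; linarith
    | succ j ih =>
      have hj' := ih (by omega)
      have hp := potential_step (g := g j) (a := a (j + 2)) (b := b (j + 1)) (c := c (j + 1))
        (g' := g (j + 1)) (hodd j (by omega)) (by simp only [hr]; ring)
      rw [← hstep j (by omega)] at hp
      rw [Finset.sum_range_succ]
      push_cast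
      linarith
  have hend := htel m le_rfl
  have hlast := potential_le_abs (r m) (g m)
  have habs : |r m + g m| ≤ |b (m + 1)| + |c (m + 1)| + |g (m + 1)| := by
    rw [show r m + g m = b (m + 1) + c (m + 1) + g (m + 1) by simp only [hr]; ring]
    exact abs_add_three _ _ _
  have hinit : (m : ℤ) + 2 ≤ |d| + |a 1| + potential (r 0) (g 0) := by
    have hr0 : r 0 = 2 * (m + 1) + 1 - 2 * a 1 := by simp only [hr, zero_add]; linarith
    rw [hr0, hg]
    have := le_abs_self (a 1); have := neg_le_abs (a 1)
    have := le_abs_self d; have := neg_le_abs d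
    unfold potential
    split_ifs <;> omega
  rw [Finset.sum_range_succ]
  linarith

lemma sum_mul_ite_eq (n k : ℕ) (x : ℕ → ℤ) (hx : ∀ i ∉ Finset.Icc 1 n, x i = 0) :
    ∑ i ∈ Finset.Icc 1 n, x i * (if k = i then 1 else 0) = x k := by
  simp only [mul_ite, mul_one, mul_zero, Finset.sum_ite_eq]
  split_ifs with h
  · rfl
  · exact (hx k h).symm

lemma sum_mul_ite_eq_add (n k t : ℕ) (x : ℕ → ℤ) (hx : ∀ i ∉ Finset.Icc 1 n, x i = 0) :
    ∑ i ∈ Finset.Icc 1 n, x i * (if k = i + t then 1 else 0) = x (k - t) := by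
  rw [← sum_mul_ite_eq n (k - t) x hx]
  refine Finset.sum_congr rfl fun i hi => ?_
  have := (Finset.mem_Icc.mp hi).1
  congr 2
  exact propext (by omega)

lemma two_mul_le_absSum {n : ℕ} (hn : 1 ≤ n) (φ : (Fin n → ℤ) → ℤ)
    (hφ : Ssum φ = (2 * (n : ℤ) + 1) • stdVec n 1) : 2 * (n : ℤ) ≤ absSum φ := by
  obtain ⟨m, rfl⟩ := Nat.exists_eq_add_of_le' hn
  obtain ⟨ψ, hψ, hsum, habs⟩ := exists_index_weights
    (Finset.insertNone (Finset.univ ×ˢ Finset.Icc 1 (m + 1))) (genVec (m + 1)) φ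
  rw [← Bset_eq_image_genVec] at hsum habs
  have hzero : ∀ (t : Fin 4) (i : ℕ), i ∉ Finset.Icc 1 (m + 1) → ψ (some (t, i)) = 0 :=
    fun t i hi => hψ _ (by simpa using hi)
  rw [absSum, ← habs, Finset.sum_insertNone, Finset.sum_product, Fin.sum_univ_four]
  rw [← Ssum, hφ, Finset.sum_insertNone, Finset.sum_product, Fin.sum_univ_four] at hsum
  have hcoord : ∀ k < m + 1, ψ none * ((if k + 1 = 1 then 2 else 0) - if k + 1 = 2 then 2 else 0)
      + 2 * ψ (some (0, k + 1)) + (ψ (some (1, k + 1)) + ψ (some (1, k)))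
      + (ψ (some (2, k + 1)) - ψ (some (2, k)))
      + (ψ (some (3, k + 1)) - 2 * ψ (some (3, k)) + ψ (some (3, k - 1)))
      = if k + 1 = 1 then 2 * ((m : ℤ) + 1) + 1 else 0 := by
    intro k hk
    have h := congrFun hsum ⟨k, hk⟩
    have e0 := fun t => sum_mul_ite_eq (m + 1) (k + 1) (fun i => ψ (some (t, i))) (hzero t)
    have e1 := fun t => sum_mul_ite_eq_add (m + 1) (k + 1) 1 (fun i => ψ (some (t, i))) (hzero t)
    have e2 := fun t => sum_mul_ite_eq_add (m + 1) (k + 1) 2 (fun i => ψ (some (t, i))) (hzero t)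
    simp only [genVec, Pi.add_apply, Finset.sum_apply, Pi.smul_apply, Pi.sub_apply, stdVec,
      smul_eq_mul, two_nsmul, Matrix.cons_val, mul_add, mul_sub, Finset.sum_add_distrib,
      Finset.sum_sub_distrib] at h
    simp only [e0, e1, e2, Nat.add_sub_cancel, show k + 1 - 2 = k - 1 by omega] at h
    push_cast at h
    split_ifs at h ⊢ <;> omega
  have key := two_mul_le_of_recurrence m (fun k => ψ (some (0, k))) (fun k => ψ (some (1, k)))
    (fun k => ψ (some (2, k))) (fun k => if k = 0 then -2 * ψ none else ψ (some (3, k))) (ψ none)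
    rfl ?_ ?_
  · have hIcc : ∀ F : ℕ → ℤ, ∑ i ∈ Finset.Icc 1 (m + 1), F i
        = ∑ k ∈ Finset.range (m + 1), F (k + 1) := fun F => by
      rw [← Finset.Ico_add_one_right_eq_Icc, Finset.sum_Ico_eq_sum_range]
      simp only [Nat.add_sub_cancel, add_comm 1]
    simp only [Nat.succ_ne_zero, if_false, Finset.sum_add_distrib] at key
    simp only [hIcc]
    exact_mod_cast key
  · have h := hcoord 0 (by omega)
    have h0 := fun t => hzero t 0 (by simp)
    simp [h0] at h ⊢
    linarith
  · intro k hk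
    have h := hcoord (k + 1) (by omega)
    have h0 := hzero 3 0 (by simp)
    rcases k with _ | k
    · simp [h0] at h ⊢
      linarith
    · simp at h ⊢
      linarith

/-- The weights of `(2n+1)e₁ = n·(2e₁) + Σᵢ (eᵢ - eᵢ₊₁)`. -/
def optimalWeight (n : ℕ) (v : Fin n → ℤ) : ℤ :=
  (if v = 2 • stdVec n 1 then (n : ℤ) else 0) +
    if v ∈ (Finset.Icc 1 n).image (fun i => stdVec n i - stdVec n (i + 1)) then 1 else 0

lemma injOn_stdVec_sub (n : ℕ) :
    Set.InjOn (fun i => stdVec n i - stdVec n (i + 1)) (Finset.Icc 1 n : Finset ℕ) := by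
  intro i hi j hj h
  rw [Finset.coe_Icc, Set.mem_Icc] at hi
  have h' := congrFun h ⟨i - 1, by omega⟩
  simp only [Pi.sub_apply, stdVec] at h'
  split_ifs at h' <;> omega

lemma sum_stdVec_sub {n : ℕ} :
    ∑ i ∈ Finset.Icc 1 n, (stdVec n i - stdVec n (i + 1)) = stdVec n 1 := by
  have h : stdVec n (n + 1) = 0 := funext fun i => if_neg (by have := i.2; omega)
  rw [← Finset.Ico_add_one_right_eq_Icc, Finset.sum_Ico_eq_sum_range]
  have := Finset.sum_range_sub' (fun i => stdVec n (1 + i)) n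
  simp only [add_comm, add_left_comm] at this ⊢
  simpa [h] using this

lemma two_smul_stdVec_mem {n : ℕ} (hn : 1 ≤ n) : 2 • stdVec n 1 ∈ Bset n := by
  simp only [Bset, Finset.mem_union, Finset.mem_image]
  exact .inl (.inl (.inl (.inl ⟨1, Finset.mem_Icc.mpr ⟨le_rfl, hn⟩, rfl⟩)))

lemma image_sub_subset (n : ℕ) :
    (Finset.Icc 1 n).image (fun i => stdVec n i - stdVec n (i + 1)) ⊆ Bset n := by
  intro v hv
  simp only [Bset, Finset.mem_union]
  exact .inl (.inl (.inr hv))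

lemma Ssum_optimalWeight {n : ℕ} (hn : 1 ≤ n) :
    Ssum (optimalWeight n) = (2 * (n : ℤ) + 1) • stdVec n 1 := by
  simp only [Ssum, optimalWeight, add_smul, Finset.sum_add_distrib, ite_smul, zero_smul, one_smul]
  rw [Finset.sum_ite_eq', if_pos (two_smul_stdVec_mem hn), ← Finset.sum_filter,
    Finset.filter_mem_eq_inter, Finset.inter_eq_right.mpr (image_sub_subset n),
    Finset.sum_image (injOn_stdVec_sub n), sum_stdVec_sub]
  module

lemma absSum_optimalWeight {n : ℕ} (hn : 1 ≤ n) : absSum (optimalWeight n) = 2 * n := by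
  have hnonneg : ∀ v, 0 ≤ optimalWeight n v := fun v => by
    unfold optimalWeight
    split_ifs <;> positivity
  simp only [absSum, abs_of_nonneg (hnonneg _)]
  simp only [optimalWeight, Finset.sum_add_distrib]
  rw [Finset.sum_ite_eq', if_pos (two_smul_stdVec_mem hn), ← Finset.sum_filter,
    Finset.filter_mem_eq_inter, Finset.inter_eq_right.mpr (image_sub_subset n),
    Finset.sum_image (injOn_stdVec_sub n)]
  simp
  ring

/-- For every `n ≥ 1`, the minimum of `Σ_{v ∈ B} |φ(v)|` over all `φ : B → ℤ`
satisfying `S(φ) = (2n+1)·e_1` is exactly `2n`. -/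
theorem stmt_2 (n : ℕ) (hn : 1 ≤ n) :
    IsLeast {m : ℤ | ∃ φ : (Fin n → ℤ) → ℤ,
      Ssum φ = (2 * (n : ℤ) + 1) • stdVec n 1 ∧ absSum φ = m} (2 * (n : ℤ)) := by
  constructor
  · exact ⟨optimalWeight n, Ssum_optimalWeight hn, absSum_optimalWeight hn⟩
  · rintro _ ⟨φ, hφ, rfl⟩
    exact two_mul_le_absSum hn φ hφ
end

section
/- If n ≥ 3 and φ : B → ℤ satisfies S(φ)(1) = 2n+1 and Σ_{v∈B} |φ(v)| = n+1, then the third coordinate S(φ)(3) is equal to 0 or 1. -/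
/-- The possible first and third coordinates of a vector of `Bset n`. -/
lemma coord_one_three_of_mem_Bset {n : ℕ} (hn : 3 ≤ n) {v : Fin n → ℤ} (hv : v ∈ Bset n) :
    v ⟨0, by lia⟩ = 0 ∨ (v ⟨0, by lia⟩ = 1 ∧ (v ⟨2, by lia⟩ = 0 ∨ v ⟨2, by lia⟩ = 1)) ∨
      (v ⟨0, by lia⟩ = 2 ∧ v ⟨2, by lia⟩ = 0) := by
  simp only [Bset, Finset.mem_union, Finset.mem_image, Finset.mem_Icc,
    Finset.mem_singleton] at hv
  rcases hv with (((⟨i, hi, rfl⟩ | ⟨i, hi, rfl⟩) | ⟨i, hi, rfl⟩) | rfl) | ⟨i, hi, rfl⟩ <;>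
    simp only [stdVec, two_smul, Pi.add_apply, Pi.sub_apply] <;>
    grind

/-- If `n ≥ 3` and `φ : B → ℤ` satisfies `S(φ)(1) = 2n+1` and
`Σ_{v ∈ B} |φ(v)| = n+1`, then `S(φ)(3)` is `0` or `1`. -/
theorem stmt_4 (n : ℕ) (hn : 3 ≤ n) (φ : (Fin n → ℤ) → ℤ)
    (h1 : coord (Ssum φ) 1 = 2 * (n : ℤ) + 1)
    (habs : absSum φ = (n : ℤ) + 1) :
    coord (Ssum φ) 3 = 0 ∨ coord (Ssum φ) 3 = 1 := by
  have coord_one : coord (Ssum φ) 1 = ∑ v ∈ Bset n, φ v * v ⟨0, by lia⟩ := by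
    simp [coord, Ssum, show 0 < n by lia, Finset.sum_apply]
  have coord_three : coord (Ssum φ) 3 = ∑ v ∈ Bset n, φ v * v ⟨2, by lia⟩ := by
    simp [coord, Ssum, show 2 < n by lia, Finset.sum_apply]
  have defect_sum : ∑ v ∈ Bset n, (2 * |φ v| - φ v * v ⟨0, by lia⟩) = 1 := by
    rw [Finset.sum_sub_distrib, ← Finset.mul_sum, ← coord_one, h1,
      show ∑ v ∈ Bset n, |φ v| = (n : ℤ) + 1 from habs]
    ring
  have defect_nonneg : ∀ v ∈ Bset n, 0 ≤ 2 * |φ v| - φ v * v ⟨0, by lia⟩ := by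
    intro v hv
    have le_abs := le_abs_self (φ v)
    have neg_le_abs := neg_le_abs (φ v)
    rcases coord_one_three_of_mem_Bset hn hv with h | ⟨h, -⟩ | ⟨h, -⟩ <;> rw [h] <;> lia
  have term_bounds : ∀ v ∈ Bset n, 0 ≤ φ v * v ⟨2, by lia⟩ ∧
      φ v * v ⟨2, by lia⟩ ≤ 2 * |φ v| - φ v * v ⟨0, by lia⟩ := by
    intro v hv
    have defect_le := (Finset.single_le_sum defect_nonneg hv).trans_eq defect_sum
    have le_abs := le_abs_self (φ v)
    have neg_le_abs := neg_le_abs (φ v)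
    rcases coord_one_three_of_mem_Bset hn hv with h | ⟨h, h' | h'⟩ | ⟨h, h'⟩
    · rw [h] at defect_le
      have : φ v = 0 := by lia
      simp [this]
    all_goals
      rw [h] at defect_le
      rw [h, h']
      lia
  have lower := Finset.sum_nonneg fun v hv => (term_bounds v hv).1
  have upper := (Finset.sum_le_sum fun v hv => (term_bounds v hv).2).trans_eq defect_sum
  rw [coord_three]
  lia
end

section
/- If n ≥ 2 and φ : B → ℤ satisfies S(φ)(1) = 2n+1 and S(φ)(2) = 0 (with no condition on the remaining coordinates of S(φ)), then Σ_{v∈B} |φ(v)| ≥ n+2. -/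
/-- The possible pairs of first two coordinates of an element of `Bset n`. -/
theorem first_two_coords_of_mem_Bset {n : ℕ} (hn : 2 ≤ n) {v : Fin n → ℤ} (hv : v ∈ Bset n) :
    (v ⟨0, by omega⟩ = 2 ∧ (v ⟨1, by omega⟩ = 0 ∨ v ⟨1, by omega⟩ = -2)) ∨
    (v ⟨0, by omega⟩ = 1 ∧
      (v ⟨1, by omega⟩ = 1 ∨ v ⟨1, by omega⟩ = -1 ∨ v ⟨1, by omega⟩ = -2)) ∨
    v ⟨0, by omega⟩ = 0 := by
  simp only [Bset, Finset.mem_union, Finset.mem_image, Finset.mem_Icc, Finset.mem_singleton] at hv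
  rcases hv with (((⟨i, hi, rfl⟩ | ⟨i, hi, rfl⟩) | ⟨i, hi, rfl⟩) | rfl) | ⟨i, hi, rfl⟩
  all_goals
    simp only [Pi.add_apply, Pi.sub_apply, Pi.smul_apply, stdVec]
    grind

/-- If `2 * ∑ |c| - ∑ c * a` equals `1`, where every nonzero `a` is `2` with `b ∈ {0, -2}` or `1`
with `b ∈ {1, -1, -2}`, then `∑ c * b ≠ 0`. -/
theorem sum_mul_ne_zero_of_loss_eq_one {ι : Type*} (s : Finset ι) (c a b : ι → ℤ)
    (hab : ∀ v ∈ s, (a v = 2 ∧ (b v = 0 ∨ b v = -2)) ∨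
      (a v = 1 ∧ (b v = 1 ∨ b v = -1 ∨ b v = -2)) ∨ a v = 0)
    (hloss : ∑ v ∈ s, (2 * |c v| - c v * a v) = 1) :
    ∑ v ∈ s, c v * b v ≠ 0 := by
  classical
  have hnonneg : ∀ v ∈ s, 0 ≤ 2 * |c v| - c v * a v := by
    intro v hv
    have := le_abs_self (c v)
    have := abs_nonneg (c v)
    rcases hab v hv with ⟨h, -⟩ | ⟨h, -⟩ | h <;> rw [h] <;> linarith
  obtain ⟨w, hw, hw0⟩ : ∃ w ∈ s, 2 * |c w| - c w * a w ≠ 0 :=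
    Finset.exists_ne_zero_of_sum_ne_zero (by rw [hloss]; exact one_ne_zero)
  have hnonneg' : ∀ v ∈ s.erase w, 0 ≤ 2 * |c v| - c v * a v :=
    fun v hv => hnonneg v (Finset.mem_of_mem_erase hv)
  have hsplit := Finset.add_sum_erase s (fun v => 2 * |c v| - c v * a v) hw
  have hrest := Finset.sum_nonneg hnonneg'
  have hwpos := lt_of_le_of_ne (hnonneg w hw) hw0.symm
  simp only [hloss] at hsplit
  have hzero := (Finset.sum_eq_zero_iff_of_nonneg hnonneg').1 (by omega)
  have hterm : ∀ v ∈ s.erase w, c v * b v ≤ 0 ∧ 2 ∣ c v * b v := by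
    intro v hv
    have hl := hzero v hv
    rcases hab v (Finset.mem_of_mem_erase hv) with ⟨h, h' | h'⟩ | ⟨h, -⟩ | h <;>
      rw [h] at hl
    · simp [h']
    · rw [h']
      have := abs_nonneg (c v)
      omega
    all_goals
      have hc : c v = 0 := by
        rcases abs_cases (c v) with h'' | h'' <;> omega
      simp [hc]
  have hle := Finset.sum_nonpos fun v hv => (hterm v hv).1
  have hdvd := Finset.dvd_sum fun v hv => (hterm v hv).2
  rw [← Finset.add_sum_erase s (fun v => c v * b v) hw]
  have hw1 : 2 * |c w| - c w * a w = 1 := by omega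
  rcases abs_cases (c w) with ⟨hc, -⟩ | ⟨hc, -⟩ <;> rw [hc] at hw1 <;>
    rcases hab w hw with ⟨h, -⟩ | ⟨h, h' | h' | h'⟩ | h <;> rw [h] at hw1 <;>
    first
      | omega
      | (simp only [h']; omega)

/-- If `n ≥ 2` and `φ : B → ℤ` satisfies `S(φ)(1) = 2n+1` and `S(φ)(2) = 0`
(no condition on the remaining coordinates), then `Σ_{v ∈ B} |φ(v)| ≥ n+2`. -/
theorem stmt_5 (n : ℕ) (hn : 2 ≤ n) (φ : (Fin n → ℤ) → ℤ)
    (h1 : coord (Ssum φ) 1 = 2 * (n : ℤ) + 1)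
    (h2 : coord (Ssum φ) 2 = 0) :
    (n : ℤ) + 2 ≤ absSum φ := by
  have hφ : ∀ i : Fin n, Ssum φ i = ∑ v ∈ Bset n, φ v * v i := fun i => by
    simp [Ssum]
  have h1' : ∑ v ∈ Bset n, φ v * v ⟨0, by omega⟩ = 2 * (n : ℤ) + 1 := by
    rw [← hφ, ← h1, coord, dif_pos (by omega)]
  have h2' : ∑ v ∈ Bset n, φ v * v ⟨1, by omega⟩ = 0 := by
    rw [← hφ, ← h2, coord, dif_pos (by omega)]
  have hab := fun v (hv : v ∈ Bset n) => first_two_coords_of_mem_Bset hn hv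
  by_contra! hlt
  refine sum_mul_ne_zero_of_loss_eq_one (Bset n) φ _ _ hab ?_ h2'
  have hnonneg : 0 ≤ ∑ v ∈ Bset n, (2 * |φ v| - φ v * v ⟨0, by omega⟩) := by
    refine Finset.sum_nonneg fun v hv => ?_
    have := le_abs_self (φ v)
    have := abs_nonneg (φ v)
    rcases hab v hv with ⟨h, -⟩ | ⟨h, -⟩ | h <;> rw [h] <;> linarith
  rw [Finset.sum_sub_distrib, ← Finset.mul_sum, h1'] at hnonneg ⊢
  rw [absSum] at hlt
  omega
end

section
/- If n ≥ 4 and φ : B → ℤ satisfies S(φ)(1) = 2n+1, S(φ)(2) = 0, and Σ_{v∈B} |φ(v)| = n+2, then the fourth coordinate S(φ)(4) is equal to −1, 0, or 1. -/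
/-- The possible values of the first, second and fourth coordinate of a vector of `Bset n`. -/
def CoordPattern (a b c : ℤ) : Prop :=
  (a = 2 ∧ c = 0 ∧ (b = 0 ∨ b = -2)) ∨
  (a = 1 ∧ c = 0 ∧ (b = 1 ∨ b = -1 ∨ b = -2)) ∨
  (a = 0 ∧ -2 ≤ c ∧ c ≤ 2 ∧ (c = 2 ∨ c = -2 → b = 0))

theorem CoordPattern.neg_right {a b c : ℤ} (h : CoordPattern a b c) :
    CoordPattern a b (-c) := by
  unfold CoordPattern at *
  omega

theorem coordPattern_of_mem_Bset {n : ℕ} {v : Fin n → ℤ} (hv : v ∈ Bset n)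
    (h0 : 0 < n) (h1 : 1 < n) (h3 : 3 < n) :
    CoordPattern (v ⟨0, h0⟩) (v ⟨1, h1⟩) (v ⟨3, h3⟩) := by
  simp only [Bset, Finset.mem_union, Finset.mem_image, Finset.mem_Icc,
    Finset.mem_singleton] at hv
  unfold CoordPattern
  rcases hv with (((⟨i, hi, rfl⟩ | ⟨i, hi, rfl⟩) | ⟨i, hi, rfl⟩) | rfl) | ⟨i, hi, rfl⟩ <;>
    simp only [stdVec, Pi.add_apply, Pi.sub_apply, two_nsmul] <;>
    split_ifs <;> omega

/-- The excess `2|x| - x(a + c)` is nonnegative. -/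
theorem CoordPattern.excess_nonneg {a b c : ℤ} (h : CoordPattern a b c) (x : ℤ) :
    0 ≤ 2 * |x| - x * (a + c) := by
  have hb : |a + c| ≤ 2 := by
    unfold CoordPattern at h
    rw [abs_le]
    omega
  have hx := mul_le_mul_of_nonneg_left hb (abs_nonneg x)
  rw [← abs_mul] at hx
  linarith [le_abs_self (x * (a + c))]

theorem CoordPattern.of_odd {a b c x : ℤ} (h : CoordPattern a b c) (hx : Odd (x * a)) :
    a = 1 ∧ c = 0 ∧ (b = 1 ∨ b = -1 ∨ b = -2) := by
  rcases h with ⟨rfl, -⟩ | h | ⟨rfl, -⟩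
  · exact absurd hx (by simp)
  · exact h
  · exact absurd hx (by simp)

theorem CoordPattern.of_excess_eq_zero {a b c x : ℤ} (h : CoordPattern a b c)
    (hx : 2 * |x| - x * (a + c) = 0) : x * b ≤ 0 ∧ Even (x * b) := by
  rcases h with ⟨rfl, rfl, rfl | rfl⟩ | ⟨rfl, rfl, -⟩ | ⟨rfl, hc, hc', hb⟩
  · simp
  · have : 0 ≤ x := by
      have := abs_nonneg x
      linarith
    exact ⟨by linarith, by simp⟩
  · have : x = 0 := by
      rcases abs_cases x with h | h <;> omega
    simp [this]
  · by_cases hc2 : c = 2 ∨ c = -2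
    · simp [hb hc2]
    · have : x = 0 := by
        have hb : |c| ≤ 1 := by
          rw [abs_le]
          omega
        have hle := mul_le_mul_of_nonneg_left hb (abs_nonneg x)
        rw [← abs_mul] at hle
        have := le_abs_self (x * c)
        have := abs_nonneg x
        exact abs_eq_zero.mp (by linarith)
      simp [this]

theorem sum_mul_le_one_of_coordPattern {ι : Type*} (s : Finset ι) (φ a b c : ι → ℤ) (N : ℤ)
    (h : ∀ v ∈ s, CoordPattern (a v) (b v) (c v))
    (ha : ∑ v ∈ s, φ v * a v = 2 * N + 1) (hb : ∑ v ∈ s, φ v * b v = 0)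
    (hφ : ∑ v ∈ s, |φ v| = N + 2) : ∑ v ∈ s, φ v * c v ≤ 1 := by
  classical
  by_contra! hc
  obtain ⟨v, hv, hodd⟩ : ∃ v ∈ s, Odd (φ v * a v) := by
    by_contra! hne
    have := Finset.even_sum (s := s) (fun v => φ v * a v) fun v hv =>
      Int.not_odd_iff_even.mp (hne v hv)
    rw [ha] at this
    exact absurd this (by simp)
  have htot : ∑ v ∈ s, (2 * |φ v| - φ v * (a v + c v)) ≤ 1 := by
    simp only [mul_add, Finset.sum_sub_distrib, Finset.sum_add_distrib, ← Finset.mul_sum]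
    linarith
  have hrest : ∀ w ∈ s.erase v, 0 ≤ 2 * |φ w| - φ w * (a w + c w) := fun w hw =>
    (h w (Finset.mem_of_mem_erase hw)).excess_nonneg _
  rw [← Finset.add_sum_erase s _ hv] at htot hb
  obtain ⟨hav, hcv, hbv⟩ := (h v hv).of_odd hodd
  rw [hav, mul_one] at hodd
  have hsum := Finset.sum_nonneg hrest
  rw [hav, hcv] at htot
  have hφv : φ v = 1 := by
    obtain ⟨k, hk⟩ := hodd
    rcases abs_cases (φ v) with h | h <;> omega
  have hzero : ∑ w ∈ s.erase v, (2 * |φ w| - φ w * (a w + c w)) = 0 := by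
    rw [hφv, abs_one] at htot
    linarith
  have hw : ∀ w ∈ s.erase v, φ w * b w ≤ 0 ∧ Even (φ w * b w) := fun w hw =>
    (h w (Finset.mem_of_mem_erase hw)).of_excess_eq_zero
      ((Finset.sum_eq_zero_iff_of_nonneg hrest).mp hzero w hw)
  have hle := Finset.sum_nonpos fun w hws => (hw w hws).1
  obtain ⟨k, hk⟩ := Finset.even_sum (s := s.erase v) (fun w => φ w * b w) fun w hws => (hw w hws).2
  rw [hφv] at hb
  omega

theorem coord_succ_Ssum {n : ℕ} (φ : (Fin n → ℤ) → ℤ) {i : ℕ} (hi : i < n) :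
    coord (Ssum φ) (i + 1) = ∑ v ∈ Bset n, φ v * v ⟨i, hi⟩ := by
  simp [coord, Ssum, hi, Finset.sum_apply]

/-- If `n ≥ 4` and `φ : B → ℤ` satisfies `S(φ)(1) = 2n+1`, `S(φ)(2) = 0`, and
`Σ_{v ∈ B} |φ(v)| = n+2`, then `S(φ)(4)` is `−1`, `0`, or `1`. -/
theorem stmt_6 (n : ℕ) (hn : 4 ≤ n) (φ : (Fin n → ℤ) → ℤ)
    (h1 : coord (Ssum φ) 1 = 2 * (n : ℤ) + 1)
    (h2 : coord (Ssum φ) 2 = 0)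
    (habs : absSum φ = (n : ℤ) + 2) :
    coord (Ssum φ) 4 = -1 ∨ coord (Ssum φ) 4 = 0 ∨ coord (Ssum φ) 4 = 1 := by
  rw [coord_succ_Ssum φ (show 0 < n by omega)] at h1
  rw [coord_succ_Ssum φ (show 1 < n by omega)] at h2
  rw [coord_succ_Ssum φ (show 3 < n by omega)]
  have hB : ∀ v ∈ Bset n, CoordPattern (v ⟨0, by omega⟩) (v ⟨1, by omega⟩) (v ⟨3, by omega⟩) :=
    fun v hv => coordPattern_of_mem_Bset hv _ _ _
  have hle := sum_mul_le_one_of_coordPattern _ φ _ _ _ n hB h1 h2 habs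
  have hge := sum_mul_le_one_of_coordPattern _ φ _ _ _ n (fun v hv => (hB v hv).neg_right)
    h1 h2 habs
  simp only [mul_neg, Finset.sum_neg_distrib] at hge
  omega
end

section
/- Let n ≥ 3 and let k be an integer with 1 ≤ k ≤ n−2. If φ : B → ℤ satisfies S(φ)(1) = 2n+1, S(φ)(i) = 0 for every i with 2 ≤ i ≤ k, and Σ_{v∈B} |φ(v)| = n+k, then the coordinate S(φ)(k+2) is equal to −1, 0, or 1. -/
open Finset in
theorem Bset_eq_union (n : ℕ) :
    Bset n =
      ((((Icc 1 n).image fun i => 2 • stdVec n i) ∪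
      ((Icc 1 n).image fun i => stdVec n i + stdVec n (i + 1))) ∪
      (((Icc 1 n).filter (· < n)).image fun i => stdVec n i - stdVec n (i + 1))) ∪
      (((Icc 1 n).filter (· < n)).image
        fun i => stdVec n i - 2 • stdVec n (i + 1) + stdVec n (i + 2)) ∪
      {2 • stdVec n 1 - 2 • stdVec n 2} := by
  have zero_of_lt (j : ℕ) (hj : n < j) : stdVec n j = 0 := by
    funext i
    have := i.2
    simp only [stdVec, Pi.zero_apply]
    rw [if_neg (by omega)]
  ext v
  simp only [Bset, mem_union, mem_image, mem_Icc, mem_filter, mem_singleton]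
  constructor
  · rintro ((((h | h) | ⟨i, hi, rfl⟩) | h) | ⟨i, hi, rfl⟩)
    · exact Or.inl (Or.inl (Or.inl (Or.inl h)))
    · exact Or.inl (Or.inl (Or.inl (Or.inr h)))
    · by_cases hin : i < n
      · exact Or.inl (Or.inl (Or.inr ⟨i, ⟨hi, hin⟩, rfl⟩))
      · exact Or.inl (Or.inl (Or.inl (Or.inr ⟨i, hi, by simp [zero_of_lt (i + 1) (by omega)]⟩)))
    · exact Or.inr h
    · by_cases hin : i < n
      · exact Or.inl (Or.inr ⟨i, ⟨hi, hin⟩, rfl⟩)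
      · exact Or.inl (Or.inl (Or.inl (Or.inr ⟨i, hi, by
          simp [zero_of_lt (i + 1) (by omega), zero_of_lt (i + 2) (by omega)]⟩)))
  · rintro ((((h | h) | ⟨i, hi, rfl⟩) | ⟨i, hi, rfl⟩) | h)
    · exact Or.inl (Or.inl (Or.inl (Or.inl h)))
    · exact Or.inl (Or.inl (Or.inl (Or.inr h)))
    · exact Or.inl (Or.inl (Or.inr ⟨i, hi.1, rfl⟩))
    · exact Or.inr ⟨i, hi.1, rfl⟩
    · exact Or.inl (Or.inr h)

open Finset in
/-- The vectors listed in the definition of `Bset` are pairwise distinct, except that the three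
families other than `2e_i` share the vector `e_n`. -/
theorem sum_Bset {n : ℕ} (hn : 3 ≤ n) (g : (Fin n → ℤ) → ℤ) :
    ∑ v ∈ Bset n, g v =
      ∑ i ∈ Icc 1 n, (g (2 • stdVec n i) + g (stdVec n i + stdVec n (i + 1)) +
        (if i < n then g (stdVec n i - stdVec n (i + 1)) else 0) +
        (if i < n then g (stdVec n i - 2 • stdVec n (i + 1) + stdVec n (i + 2)) else 0)) +
      g (2 • stdVec n 1 - 2 • stdVec n 2) := by
  have apply_eq {v w : Fin n → ℤ} (h : v = w) (i : ℕ) (h1 : 1 ≤ i) (h2 : i ≤ n) :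
      v ⟨i - 1, by omega⟩ = w ⟨i - 1, by omega⟩ := by rw [h]
  rw [Bset_eq_union n, sum_union, sum_union, sum_union, sum_union,
    sum_image, sum_image, sum_image, sum_image,
    sum_singleton, sum_filter, sum_filter, sum_add_distrib, sum_add_distrib, sum_add_distrib]
  all_goals
    simp only [Set.InjOn, disjoint_left, mem_union, mem_image, mem_Icc, mem_filter, mem_singleton,
      coe_filter, coe_Icc, Set.mem_ofPred_eq, Set.mem_Icc]
  · intro i hi j hj h
    have e1 := apply_eq h i (by omega) (by omega)
    have e2 := apply_eq h j (by omega) (by omega)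
    simp only [stdVec, two_nsmul, Pi.add_apply, Pi.sub_apply] at e1 e2
    omega
  · intro i hi j hj h
    have e1 := apply_eq h i (by omega) (by omega)
    have e2 := apply_eq h j (by omega) (by omega)
    simp only [stdVec, Pi.sub_apply] at e1 e2
    omega
  · intro i hi j hj h
    have e1 := apply_eq h i (by omega) (by omega)
    have e2 := apply_eq h j (by omega) (by omega)
    simp only [stdVec, Pi.add_apply] at e1 e2
    omega
  · intro i hi j hj h
    have e1 := apply_eq h i (by omega) (by omega)
    have e2 := apply_eq h j (by omega) (by omega)
    simp only [stdVec, two_nsmul, Pi.add_apply] at e1 e2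
    omega
  · rintro v ⟨i, hi, rfl⟩ ⟨j, hj, h⟩
    have e1 := apply_eq h i (by omega) (by omega)
    simp only [stdVec, two_nsmul, Pi.add_apply] at e1
    omega
  · rintro v (⟨i, hi, rfl⟩ | ⟨i, hi, rfl⟩) ⟨j, hj, h⟩
    · have e1 := apply_eq h i (by omega) (by omega)
      simp only [stdVec, two_nsmul, Pi.add_apply, Pi.sub_apply] at e1
      omega
    · have e1 := apply_eq h (j + 1) (by omega) (by omega)
      simp only [stdVec, Pi.add_apply, Pi.sub_apply] at e1
      omega
  · rintro v ((⟨i, hi, rfl⟩ | ⟨i, hi, rfl⟩) | ⟨i, hi, rfl⟩) ⟨j, hj, h⟩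
    · have e1 := apply_eq h i (by omega) (by omega)
      simp only [stdVec, two_nsmul, Pi.add_apply, Pi.sub_apply] at e1
      omega
    all_goals
      have e1 := apply_eq h (j + 1) (by omega) (by omega)
      simp only [stdVec, two_nsmul, Pi.add_apply, Pi.sub_apply] at e1
      omega
  · rintro v (((⟨i, hi, rfl⟩ | ⟨i, hi, rfl⟩) | ⟨i, hi, rfl⟩) | ⟨i, hi, rfl⟩) h
    all_goals
      have e1 := apply_eq h 1 (by omega) (by omega)
      have e2 := apply_eq h 2 (by omega) (by omega)
      simp only [stdVec, two_nsmul, Pi.add_apply, Pi.sub_apply] at e1 e2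
      split_ifs at e1 e2 <;> omega

open Finset in
theorem sum_mul_indicator {n : ℕ} (x : ℕ → ℤ) (hx0 : x 0 = 0) (m r : ℕ) (hm : m ≤ n) :
    ∑ i ∈ Icc 1 n, x i * (if m = i + r then 1 else 0) = x (m - r) := by
  by_cases h : 1 ≤ m - r
  · rw [sum_eq_single (m - r)]
    · rw [if_pos (by omega), mul_one]
    · intro i _ hi
      rw [if_neg (by omega), mul_zero]
    · intro hi
      exact absurd (mem_Icc.2 ⟨h, by omega⟩) hi
  · rw [show m - r = 0 by omega, hx0]
    refine sum_eq_zero fun i hi => ?_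
    have := (mem_Icc.1 hi).1
    rw [if_neg (by omega), mul_zero]

open Finset in
theorem coord_Ssum {n : ℕ} (hn : 3 ≤ n) (φ : (Fin n → ℤ) → ℤ) (a b c f : ℕ → ℤ)
    (ha0 : a 0 = 0) (hb0 : b 0 = 0) (hc0 : c 0 = 0) (hf0 : f 0 = 0)
    (ha : ∀ i, 1 ≤ i → a i = φ (2 • stdVec n i))
    (hb : ∀ i, 1 ≤ i → b i = φ (stdVec n i + stdVec n (i + 1)))
    (hc : ∀ i, 1 ≤ i → c i = if i < n then φ (stdVec n i - stdVec n (i + 1)) else 0)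
    (hf : ∀ i, 1 ≤ i → f i =
      if i < n then φ (stdVec n i - 2 • stdVec n (i + 1) + stdVec n (i + 2)) else 0)
    (m : ℕ) (hm1 : 1 ≤ m) (hmn : m ≤ n) :
    coord (Ssum φ) m = 2 * a m + (b m + b (m - 1)) + (c m - c (m - 1)) +
      (f m - 2 * f (m - 1) + f (m - 2)) +
      φ (2 • stdVec n 1 - 2 • stdVec n 2) *
        ((if m = 1 then 2 else 0) - (if m = 2 then 2 else 0)) := by
  have hm : m - 1 + 1 = m := by omega
  rw [coord, dif_pos (by omega), Ssum, Finset.sum_apply]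
  simp only [Pi.smul_apply, smul_eq_mul]
  rw [sum_Bset hn fun v => φ v * v ⟨m - 1, by omega⟩]
  trans ∑ i ∈ Icc 1 n, (2 * (a i * (if m = i + 0 then 1 else 0)) +
      (b i * (if m = i + 0 then 1 else 0) + b i * (if m = i + 1 then 1 else 0)) +
      (c i * (if m = i + 0 then 1 else 0) - c i * (if m = i + 1 then 1 else 0)) +
      (f i * (if m = i + 0 then 1 else 0) - 2 * (f i * (if m = i + 1 then 1 else 0)) +
        f i * (if m = i + 2 then 1 else 0))) +
      φ (2 • stdVec n 1 - 2 • stdVec n 2) *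
        (2 • stdVec n 1 - 2 • stdVec n 2 : Fin n → ℤ) ⟨m - 1, by omega⟩
  · congr 1
    refine sum_congr rfl fun i hi => ?_
    have hi1 := (mem_Icc.1 hi).1
    rw [ha i hi1, hb i hi1, hc i hi1, hf i hi1]
    rw [← ite_zero_mul, ← ite_zero_mul]
    simp only [stdVec, two_nsmul, Pi.add_apply, Pi.sub_apply, hm, add_zero]
    ring
  simp only [sum_add_distrib, sum_sub_distrib, ← mul_sum]
  rw [sum_mul_indicator a ha0 m 0 hmn, sum_mul_indicator b hb0 m 0 hmn,
    sum_mul_indicator b hb0 m 1 hmn, sum_mul_indicator c hc0 m 0 hmn,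
    sum_mul_indicator c hc0 m 1 hmn, sum_mul_indicator f hf0 m 0 hmn,
    sum_mul_indicator f hf0 m 1 hmn, sum_mul_indicator f hf0 m 2 hmn]
  simp only [stdVec, two_nsmul, Pi.add_apply, Pi.sub_apply, hm, Nat.sub_zero]
  split_ifs <;> ring

/-- If the odd entry `N` in coordinate `1` is cancelled in the coordinates `2, …, i`, then the part
of the combination supported on vectors with leading index at most `i` is costly. Here
`b i - c i - 2 * f i + f (i - 1)` (with a correction for `i = 1`) and `f i` are the contributions
of that part to the coordinates `i + 1` and `i + 2`. -/
theorem cost_lower_bound (a b c f : ℕ → ℤ) (d N : ℤ) (hf0 : f 0 = 0) (hN : N % 2 = 1) (k : ℕ)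
    (h1 : 2 * a 1 + b 1 + c 1 + f 1 + 2 * d = N)
    (p : ℕ → ℤ)
    (hp : ∀ i, p i = b i - c i - 2 * f i + f (i - 1) - (if i = 1 then 2 * d else 0))
    (h0 : ∀ i, 1 ≤ i → i + 1 ≤ k →
      2 * a (i + 1) + b (i + 1) + c (i + 1) + f (i + 1) + p i = 0)
    (i : ℕ) (hi : 1 ≤ i) (hik : i ≤ k) :
    (p i + f i) % 2 = 1 ∧
    2 * (∑ j ∈ Finset.Icc 1 i, (|a j| + |b j| + |c j| + |f j|) + |d|) - N ≥
      2 * i - 1 + (|f i| - f i % 2 + if p i = 0 ∧ |f i| = 1 then 2 else 0) := by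
  induction i, hi using Nat.le_induction with
  | base =>
    have hp1 := hp 1
    rw [if_pos rfl, Nat.sub_self, hf0] at hp1
    rw [Finset.Icc_self, Finset.sum_singleton]
    generalize p 1 = P at *
    generalize a 1 = A at *
    generalize b 1 = B at *
    generalize c 1 = C at *
    generalize f 1 = F at *
    refine ⟨by omega, ?_⟩
    have := abs_cases A
    have := abs_cases B
    have := abs_cases C
    have := abs_cases F
    have := abs_cases d
    push_cast
    split_ifs <;> omega
  | succ i hi ih =>
    obtain ⟨ih1, ih2⟩ := ih (by omega)
    have hp1 := hp (i + 1)
    have hz := h0 i hi hik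
    rw [if_neg (by omega), Nat.add_sub_cancel] at hp1
    rw [Finset.sum_Icc_succ_top (by omega)]
    generalize ∑ j ∈ Finset.Icc 1 i, (|a j| + |b j| + |c j| + |f j|) = s at *
    generalize p (i + 1) = P at *
    generalize a (i + 1) = A at *
    generalize b (i + 1) = B at *
    generalize c (i + 1) = C at *
    generalize f (i + 1) = F at *
    generalize p i = Q at *
    generalize f i = G at *
    clear hp h0 h1 ih hf0
    refine ⟨by omega, ?_⟩
    have hG := abs_cases G
    have hF := abs_cases F
    have hA := abs_nonneg A
    have hB := abs_nonneg B
    have hC := abs_nonneg C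
    have hge : |G| - G % 2 ≥ 0 := by omega
    by_cases hBC : |B| + |C| = 0
    · obtain rfl : B = 0 := abs_eq_zero.1 (by omega)
      obtain rfl : C = 0 := abs_eq_zero.1 (by omega)
      rw [abs_zero] at *
      by_cases hF0 : F = 0
      · subst hF0
        have := abs_cases A
        push_cast
        split_ifs at ih2 ⊢ <;> omega
      · have : |F| ≥ 1 := by omega
        clear hBC
        push_cast
        split_ifs at ih2 ⊢ <;> omega
    · have hle : |F| - F % 2 + (if P = 0 ∧ |F| = 1 then 2 else 0) ≤ 2 * |F| := by
        split_ifs <;> omega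
      have hnn : (0 : ℤ) ≤ if Q = 0 ∧ |G| = 1 then 2 else 0 := by split_ifs <;> norm_num
      push_cast
      linarith [show 1 ≤ |B| + |C| by omega]

/-- Let `n ≥ 3` and `1 ≤ k ≤ n−2`. If `φ : B → ℤ` satisfies `S(φ)(1) = 2n+1`,
`S(φ)(i) = 0` for every `2 ≤ i ≤ k`, and `Σ_{v ∈ B} |φ(v)| = n+k`, then `S(φ)(k+2)` is
`−1`, `0`, or `1`. -/
theorem stmt_8 (n k : ℕ) (hn : 3 ≤ n) (hk1 : 1 ≤ k) (hkn : k ≤ n - 2)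
    (φ : (Fin n → ℤ) → ℤ)
    (h1 : coord (Ssum φ) 1 = 2 * (n : ℤ) + 1)
    (h0 : ∀ i : ℕ, 2 ≤ i → i ≤ k → coord (Ssum φ) i = 0)
    (habs : absSum φ = (n : ℤ) + (k : ℤ)) :
    coord (Ssum φ) (k + 2) = -1 ∨ coord (Ssum φ) (k + 2) = 0 ∨
      coord (Ssum φ) (k + 2) = 1 := by
  set d := φ (2 • stdVec n 1 - 2 • stdVec n 2) with hd
  obtain ⟨a, ha0, ha⟩ : ∃ a : ℕ → ℤ, a 0 = 0 ∧ ∀ i, 1 ≤ i → a i = φ (2 • stdVec n i) :=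
    ⟨fun i => if 1 ≤ i then φ (2 • stdVec n i) else 0, by simp, fun i hi => if_pos hi⟩
  obtain ⟨b, hb0, hb⟩ : ∃ b : ℕ → ℤ, b 0 = 0 ∧
      ∀ i, 1 ≤ i → b i = φ (stdVec n i + stdVec n (i + 1)) :=
    ⟨fun i => if 1 ≤ i then φ (stdVec n i + stdVec n (i + 1)) else 0, by simp,
      fun i hi => if_pos hi⟩
  obtain ⟨c, hc0, hc⟩ : ∃ c : ℕ → ℤ, c 0 = 0 ∧
      ∀ i, 1 ≤ i → c i = if i < n then φ (stdVec n i - stdVec n (i + 1)) else 0 :=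
    ⟨fun i => if 1 ≤ i then if i < n then φ (stdVec n i - stdVec n (i + 1)) else 0 else 0,
      by simp, fun i hi => if_pos hi⟩
  obtain ⟨f, hf0, hf⟩ : ∃ f : ℕ → ℤ, f 0 = 0 ∧ ∀ i, 1 ≤ i → f i =
      if i < n then φ (stdVec n i - 2 • stdVec n (i + 1) + stdVec n (i + 2)) else 0 :=
    ⟨fun i => if 1 ≤ i then
      if i < n then φ (stdVec n i - 2 • stdVec n (i + 1) + stdVec n (i + 2)) else 0 else 0,
      by simp, fun i hi => if_pos hi⟩
  have hcoord := coord_Ssum (by omega) φ a b c f ha0 hb0 hc0 hf0 ha hb hc hf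
  have hcost : absSum φ = ∑ j ∈ Finset.Icc 1 n, (|a j| + |b j| + |c j| + |f j|) + |d| := by
    rw [absSum, sum_Bset hn fun v => |φ v|]
    congr 1
    refine Finset.sum_congr rfl fun i hi => ?_
    have hi1 := (Finset.mem_Icc.1 hi).1
    rw [ha i hi1, hb i hi1, hc i hi1, hf i hi1]
    split_ifs <;> simp
  rw [hcoord 1 le_rfl (by omega)] at h1
  simp only [Nat.sub_self, hb0, hc0, hf0, Nat.reduceSub, if_true, ← hd] at h1
  norm_num at h1
  obtain ⟨-, hbound⟩ := cost_lower_bound a b c f d (2 * n + 1) hf0 (by omega) k (by linarith)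
    (fun i => b i - c i - 2 * f i + f (i - 1) - (if i = 1 then 2 * d else 0)) (fun _ => rfl)
    (fun i hi hik => by
      have h := h0 (i + 1) (by omega) hik
      rw [hcoord (i + 1) (by omega) (by omega), if_neg (by omega), Nat.add_sub_cancel,
        show i + 1 - 2 = i - 1 by omega, ← hd] at h
      simp only [show i + 1 = 2 ↔ i = 1 by omega] at h
      split_ifs at h ⊢ <;> linarith) k hk1 le_rfl
  have hsum : ∑ j ∈ Finset.Icc 1 (k + 2), (|a j| + |b j| + |c j| + |f j|) ≤
      ∑ j ∈ Finset.Icc 1 n, (|a j| + |b j| + |c j| + |f j|) :=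
    Finset.sum_le_sum_of_subset_of_nonneg (Finset.Icc_subset_Icc_right (by omega))
      fun i _ _ => by positivity
  rw [Finset.sum_Icc_succ_top (by omega), Finset.sum_Icc_succ_top (by omega)] at hsum
  rw [hcoord (k + 2) (by omega) (by omega), if_neg (by omega), if_neg (by omega),
    Nat.add_sub_cancel, show k + 2 - 1 = k + 1 by omega]
  rw [hcost] at habs
  simp only [show k + 1 + 1 = k + 2 by omega] at hsum
  have hextra : (0 : ℤ) ≤ if b k - c k - 2 * f k + f (k - 1) - (if k = 1 then 2 * d else 0) = 0 ∧
      |f k| = 1 then 2 else 0 := by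
    split_ifs <;> norm_num
  have hfk := abs_cases (f k)
  have hnonneg : 0 ≤ |f k| - f k % 2 := by omega
  have := abs_nonneg (a (k + 1))
  have := abs_nonneg (b (k + 1))
  have := abs_nonneg (c (k + 1))
  have := abs_nonneg (f (k + 1))
  have := abs_nonneg (a (k + 2))
  have := abs_nonneg (b (k + 2))
  have := abs_nonneg (c (k + 2))
  have := abs_nonneg (f (k + 2))
  have hle : 2 * (|a (k + 1)| + |b (k + 1)| + |c (k + 1)| + |f (k + 1)| +
      (|a (k + 2)| + |b (k + 2)| + |c (k + 2)| + |f (k + 2)|)) + (|f k| - f k % 2) ≤ 0 := by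
    linarith
  rw [abs_eq_zero.1 (show |b (k + 1)| = 0 by linarith),
    abs_eq_zero.1 (show |c (k + 1)| = 0 by linarith),
    abs_eq_zero.1 (show |f (k + 1)| = 0 by linarith),
    abs_eq_zero.1 (show |a (k + 2)| = 0 by linarith),
    abs_eq_zero.1 (show |b (k + 2)| = 0 by linarith),
    abs_eq_zero.1 (show |c (k + 2)| = 0 by linarith),
    abs_eq_zero.1 (show |f (k + 2)| = 0 by linarith)]
  have hle' : |f k| - f k % 2 ≤ 0 := by linarith
  clear hle hbound hextra
  omega
end

section
/- If n ≥ 1 and φ : B → ℤ satisfies S(φ)(1) = 2n+1 and Σ_{v∈B} |φ(v)| = n+1, then φ(2e_1) + φ(2e_1 − 2e_2) = |φ(2e_1)| + |φ(2e_1 − 2e_2)| = n and φ(e_1 + e_2) + φ(e_1 − e_2) + φ(e_1 − 2e_2 + e_3) = |φ(e_1 + e_2)| + |φ(e_1 − e_2)| + |φ(e_1 − 2e_2 + e_3)| = 1 (with the convention that e_j = 0 for j > n, and where for n small enough that some of these vectors coincide as elements of B the corresponding terms are counted once). -/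
theorem stdVec_apply_zero {n : ℕ} (hn : 0 < n) (j : ℕ) :
    stdVec n j ⟨0, hn⟩ = if j = 1 then 1 else 0 := by
  simp [stdVec, eq_comm]

/-- The vectors of `B` with first coordinate `2`. -/
def leadTwo (n : ℕ) : Finset (Fin n → ℤ) :=
  {2 • stdVec n 1, 2 • stdVec n 1 - 2 • stdVec n 2}

/-- The vectors of `B` with first coordinate `1`. -/
def leadOne (n : ℕ) : Finset (Fin n → ℤ) :=
  {stdVec n 1 + stdVec n 2, stdVec n 1 - stdVec n 2,
    stdVec n 1 - 2 • stdVec n 2 + stdVec n 3}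

theorem apply_zero_of_mem_leadTwo {n : ℕ} (hn : 0 < n) {v : Fin n → ℤ} (hv : v ∈ leadTwo n) :
    v ⟨0, hn⟩ = 2 := by
  simp only [leadTwo, Finset.mem_insert, Finset.mem_singleton] at hv
  rcases hv with rfl | rfl <;> simp [stdVec_apply_zero hn]

theorem apply_zero_of_mem_leadOne {n : ℕ} (hn : 0 < n) {v : Fin n → ℤ} (hv : v ∈ leadOne n) :
    v ⟨0, hn⟩ = 1 := by
  simp only [leadOne, Finset.mem_insert, Finset.mem_singleton] at hv
  rcases hv with rfl | rfl | rfl <;> simp [stdVec_apply_zero hn]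

theorem disjoint_leadTwo_leadOne {n : ℕ} (hn : 0 < n) : Disjoint (leadTwo n) (leadOne n) := by
  rw [Finset.disjoint_left]
  intro v h2 h1
  have := apply_zero_of_mem_leadTwo hn h2
  have := apply_zero_of_mem_leadOne hn h1
  omega

theorem leadTwo_union_leadOne_subset {n : ℕ} (hn : 0 < n) :
    leadTwo n ∪ leadOne n ⊆ Bset n := by
  have h1 : 1 ∈ Finset.Icc 1 n := Finset.mem_Icc.2 ⟨le_rfl, hn⟩
  intro v hv
  simp only [leadTwo, leadOne, Finset.mem_union, Finset.mem_insert, Finset.mem_singleton] at hv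
  simp only [Bset, Finset.mem_union, Finset.mem_image, Finset.mem_singleton]
  rcases hv with (rfl | rfl) | rfl | rfl | rfl
  · exact .inl (.inl (.inl (.inl ⟨1, h1, rfl⟩)))
  · exact .inl (.inr rfl)
  · exact .inl (.inl (.inl (.inr ⟨1, h1, rfl⟩)))
  · exact .inl (.inl (.inr ⟨1, h1, rfl⟩))
  · exact .inr ⟨1, h1, rfl⟩

theorem apply_zero_eq_zero_of_mem_Bset {n : ℕ} (hn : 0 < n) {v : Fin n → ℤ} (hv : v ∈ Bset n)
    (hlead : v ∉ leadTwo n ∪ leadOne n) : v ⟨0, hn⟩ = 0 := by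
  simp only [Bset, Finset.mem_union, Finset.mem_image, Finset.mem_singleton,
    Finset.mem_Icc] at hv
  rcases hv with (((⟨i, hi, rfl⟩ | ⟨i, hi, rfl⟩) | ⟨i, hi, rfl⟩) | rfl) | ⟨i, hi, rfl⟩
  case inl.inr => simp [leadTwo] at hlead
  all_goals
    obtain rfl | hi1 := eq_or_ne i 1
    · simp [leadTwo, leadOne] at hlead
    · have : i ≠ 0 := by omega
      simp [stdVec_apply_zero hn, hi1, this]

theorem coord_Ssum_one {n : ℕ} (hn : 0 < n) (φ : (Fin n → ℤ) → ℤ) :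
    coord (Ssum φ) 1 = 2 * ∑ v ∈ leadTwo n, φ v + ∑ v ∈ leadOne n, φ v := by
  have hcoord : coord (Ssum φ) 1 = ∑ v ∈ Bset n, φ v * v ⟨0, hn⟩ := by
    simp [coord, Ssum, hn, Finset.sum_apply]
  rw [hcoord, ← Finset.sum_subset (leadTwo_union_leadOne_subset hn) fun v hv hlead => by
      rw [apply_zero_eq_zero_of_mem_Bset hn hv hlead, mul_zero],
    Finset.sum_union (disjoint_leadTwo_leadOne hn), Finset.mul_sum]
  congr 1 <;> refine Finset.sum_congr rfl fun v hv => ?_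
  · rw [apply_zero_of_mem_leadTwo hn hv, mul_comm]
  · rw [apply_zero_of_mem_leadOne hn hv, mul_one]

theorem sum_abs_lead_le_absSum {n : ℕ} (hn : 0 < n) (φ : (Fin n → ℤ) → ℤ) :
    ∑ v ∈ leadTwo n, |φ v| + ∑ v ∈ leadOne n, |φ v| ≤ absSum φ := by
  rw [← Finset.sum_union (disjoint_leadTwo_leadOne hn)]
  exact Finset.sum_le_sum_of_subset_of_nonneg (leadTwo_union_leadOne_subset hn)
    fun v _ _ => abs_nonneg (φ v)

/-- If `n ≥ 1` and `φ : B → ℤ` satisfies `S(φ)(1) = 2n+1` and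
`Σ_{v ∈ B} |φ(v)| = n+1`, then `φ(2e_1) + φ(2e_1 − 2e_2) = |φ(2e_1)| + |φ(2e_1 − 2e_2)| = n`
and `φ(e_1+e_2) + φ(e_1−e_2) + φ(e_1−2e_2+e_3)
  = |φ(e_1+e_2)| + |φ(e_1−e_2)| + |φ(e_1−2e_2+e_3)| = 1`,
where vectors that coincide as elements of `B` are counted once (which is why the sums are
taken over `Finset`s of the vectors, deduplicating repeated elements). -/
theorem stmt_10 (n : ℕ) (hn : 1 ≤ n) (φ : (Fin n → ℤ) → ℤ)
    (h1 : coord (Ssum φ) 1 = 2 * (n : ℤ) + 1)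
    (habs : absSum φ = (n : ℤ) + 1) :
    ((∑ v ∈ ({2 • stdVec n 1, 2 • stdVec n 1 - 2 • stdVec n 2} : Finset (Fin n → ℤ)), φ v) =
        (∑ v ∈ ({2 • stdVec n 1, 2 • stdVec n 1 - 2 • stdVec n 2} :
          Finset (Fin n → ℤ)), |φ v|) ∧
      (∑ v ∈ ({2 • stdVec n 1, 2 • stdVec n 1 - 2 • stdVec n 2} :
          Finset (Fin n → ℤ)), |φ v|) = (n : ℤ)) ∧
    ((∑ v ∈ ({stdVec n 1 + stdVec n 2, stdVec n 1 - stdVec n 2,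
          stdVec n 1 - 2 • stdVec n 2 + stdVec n 3} : Finset (Fin n → ℤ)), φ v) =
        (∑ v ∈ ({stdVec n 1 + stdVec n 2, stdVec n 1 - stdVec n 2,
          stdVec n 1 - 2 • stdVec n 2 + stdVec n 3} : Finset (Fin n → ℤ)), |φ v|) ∧
      (∑ v ∈ ({stdVec n 1 + stdVec n 2, stdVec n 1 - stdVec n 2,
          stdVec n 1 - 2 • stdVec n 2 + stdVec n 3} : Finset (Fin n → ℤ)), |φ v|) = 1) := by
  have hcoord := coord_Ssum_one hn φ
  have hle := sum_abs_lead_le_absSum hn φ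
  have h2 := abs_le.1 (Finset.abs_sum_le_sum_abs φ (leadTwo n))
  have h1' := abs_le.1 (Finset.abs_sum_le_sum_abs φ (leadOne n))
  rw [h1] at hcoord
  rw [habs] at hle
  unfold leadTwo leadOne at *
  omega
end
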